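/- Refinement modal logic and refinement μ-calculus are bisimulation invariant: if M_s ≃ N_t, then for every formula φ of L_∀, M_s ⊨ φ iff N_t ⊨ φ; and for every formula φ of L^μ_∀ without free fixpoint variables, M_s ⊨ φ iff N_t ⊨ φ. -/

import Mathlib

/-- A Kripke model over agents `A` and propositional variables `P`. -/
structure KModel (A P : Type) where
  S : Type
  R : A → S → S → Prop
  V : P → S → Prop

/-- `Refines B M s N t`: there is a `B`-refinement from `M_s` to `N_t`. -/
def Refines {A P : Type} (B : Set A) (M : KModel A P) (s : M.S)
    (N : KModel A P) (t : N.S) : Prop :=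
  ∃ Z : M.S → N.S → Prop,
    Z s t ∧
    (∀ u v, Z u v → ∀ p, M.V p u ↔ N.V p v) ∧
    (∀ a : A, ∀ u v, Z u v → ∀ v', N.R a v v' → ∃ u', M.R a u u' ∧ Z u' v') ∧
    (∀ a : A, a ∉ B → ∀ u v, Z u v → ∀ u', M.R a u u' → ∃ v', N.R a v v' ∧ Z u' v')

/-- `Bisim M s N t`: there is a bisimulation between `M` and `N` linking `s` and `t`. -/
def Bisim {A P : Type} (M : KModel A P) (s : M.S) (N : KModel A P) (t : N.S) : Prop :=
  ∃ Z : M.S → N.S → Prop,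
    Z s t ∧
    (∀ u v, Z u v → ∀ p, M.V p u ↔ N.V p v) ∧
    (∀ a : A, ∀ u v, Z u v → ∀ u', M.R a u u' → ∃ v', N.R a v v' ∧ Z u' v') ∧
    (∀ a : A, ∀ u v, Z u v → ∀ v', N.R a v v' → ∃ u', M.R a u u' ∧ Z u' v')

/-- The language `L_∀` of refinement modal logic. -/
inductive RForm (A P : Type) : Type where
  | atom : P → RForm A P
  | neg : RForm A P → RForm A P
  | and : RForm A P → RForm A P → RForm A P
  | box : A → RForm A P → RForm A P
  | rall : A → RForm A P → RForm A P

/-- Satisfaction for refinement modal logic. -/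
def Sat {A P : Type} : (M : KModel A P) → M.S → RForm A P → Prop
  | M, s, .atom p => M.V p s
  | M, s, .neg φ => ¬ Sat M s φ
  | M, s, .and φ ψ => Sat M s φ ∧ Sat M s ψ
  | M, s, .box a φ => ∀ t, M.R a s t → Sat M t φ
  | M, s, .rall a φ => ∀ (N : KModel A P) (t : N.S), Refines {a} M s N t → Sat N t φ

/-- A Kripke model whose valuation also covers fixpoint variables from `X`. -/
structure MuModel (A P X : Type) where
  S : Type
  R : A → S → S → Prop
  V : P → S → Prop
  W : X → S → Prop

/-- Refinement between pointed `MuModel`s (atoms only for the variables of `P`). -/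
def MuRefines {A P X : Type} (B : Set A) (M : MuModel A P X) (s : M.S)
    (N : MuModel A P X) (t : N.S) : Prop :=
  ∃ Z : M.S → N.S → Prop,
    Z s t ∧
    (∀ u v, Z u v → ∀ p, M.V p u ↔ N.V p v) ∧
    (∀ a : A, ∀ u v, Z u v → ∀ v', N.R a v v' → ∃ u', M.R a u u' ∧ Z u' v') ∧
    (∀ a : A, a ∉ B → ∀ u v, Z u v → ∀ u', M.R a u u' → ∃ v', N.R a v v' ∧ Z u' v')

/-- Bisimulation between pointed `MuModel`s (atoms only for the variables of `P`). -/
def MuBisim {A P X : Type} (M : MuModel A P X) (s : M.S)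
    (N : MuModel A P X) (t : N.S) : Prop :=
  ∃ Z : M.S → N.S → Prop,
    Z s t ∧
    (∀ u v, Z u v → ∀ p, M.V p u ↔ N.V p v) ∧
    (∀ a : A, ∀ u v, Z u v → ∀ u', M.R a u u' → ∃ v', N.R a v v' ∧ Z u' v') ∧
    (∀ a : A, ∀ u v, Z u v → ∀ v', N.R a v v' → ∃ u', M.R a u u' ∧ Z u' v')

/-- The language `L^μ_∀` of the refinement μ-calculus. -/
inductive MuForm (A P X : Type) : Type where
  | fvar : X → MuForm A P X
  | atom : P → MuForm A P X
  | neg : MuForm A P X → MuForm A P X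
  | and : MuForm A P X → MuForm A P X → MuForm A P X
  | box : A → MuForm A P X → MuForm A P X
  | rall : A → MuForm A P X → MuForm A P X
  | mu : X → MuForm A P X → MuForm A P X

/-- `M^{[x ↦ T]}`: change the valuation of the fixpoint variable `x` to `T`. -/
def MuModel.updW {A P X : Type} (M : MuModel A P X) (x : X) (T : Set M.S) :
    MuModel A P X where
  S := M.S
  R := M.R
  V := M.V
  W := fun y u => (y = x ∧ u ∈ T) ∨ (y ≠ x ∧ M.W y u)

/-- Satisfaction for the refinement μ-calculus. -/
def MuSat {A P X : Type} : (M : MuModel A P X) → M.S → MuForm A P X → Prop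
  | M, s, .fvar x => M.W x s
  | M, s, .atom p => M.V p s
  | M, s, .neg φ => ¬ MuSat M s φ
  | M, s, .and φ ψ => MuSat M s φ ∧ MuSat M s ψ
  | M, s, .box a φ => ∀ t, M.R a s t → MuSat M t φ
  | M, s, .rall a φ => ∀ (N : MuModel A P X) (t : N.S), MuRefines {a} M s N t → MuSat N t φ
  | M, s, .mu x φ => ∀ T : Set M.S, { u : M.S | MuSat (M.updW x T) u φ } ⊆ T → s ∈ T

mutual
  /-- `x` occurs only positively (under an even number of negations). -/
  def PosIn {A P X : Type} (x : X) : MuForm A P X → Prop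
    | .fvar _ => True
    | .atom _ => True
    | .neg φ => NegIn x φ
    | .and φ ψ => PosIn x φ ∧ PosIn x ψ
    | .box _ φ => PosIn x φ
    | .rall _ φ => PosIn x φ
    | .mu y φ => y = x ∨ PosIn x φ
  /-- `x` occurs only negatively (under an odd number of negations). -/
  def NegIn {A P X : Type} (x : X) : MuForm A P X → Prop
    | .fvar y => y ≠ x
    | .atom _ => True
    | .neg φ => PosIn x φ
    | .and φ ψ => NegIn x φ ∧ NegIn x ψ
    | .box _ φ => NegIn x φ
    | .rall _ φ => NegIn x φ
    | .mu y φ => y = x ∨ NegIn x φ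
end

/-- Well-formedness: in every subformula `μx.φ`, `x` occurs only positively in `φ`. -/
def MuWF {A P X : Type} : MuForm A P X → Prop
  | .fvar _ => True
  | .atom _ => True
  | .neg φ => MuWF φ
  | .and φ ψ => MuWF φ ∧ MuWF ψ
  | .box _ φ => MuWF φ
  | .rall _ φ => MuWF φ
  | .mu x φ => MuWF φ ∧ PosIn x φ

/-- `x` occurs free in the formula. -/
def FreeIn {A P X : Type} (x : X) : MuForm A P X → Prop
  | .fvar y => y = x
  | .atom _ => False
  | .neg φ => FreeIn x φ
  | .and φ ψ => FreeIn x φ ∨ FreeIn x ψ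
  | .box _ φ => FreeIn x φ
  | .rall _ φ => FreeIn x φ
  | .mu y φ => y ≠ x ∧ FreeIn x φ

theorem Bisim.symm {A P : Type} {M N : KModel A P} {s : M.S} {t : N.S} (h : Bisim M s N t) :
    Bisim N t M s := by
  obtain ⟨Z, hst, hV, hforth, hback⟩ := h
  exact ⟨fun v u => Z u v, hst, fun u v h p => (hV v u h p).symm,
    fun a u v h => hback a v u h, fun a u v h => hforth a v u h⟩

/-- A refinement of a model is a refinement of every bisimilar model. -/
theorem Bisim.refines_trans {A P : Type} {B : Set A} {M N K : KModel A P} {s : M.S} {t : N.S}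
    {k : K.S} (h : Bisim M s N t) (hr : Refines B N t K k) : Refines B M s K k := by
  obtain ⟨Z, hst, hV, hforth, hback⟩ := h
  obtain ⟨Y, htk, hV', hback', hforth'⟩ := hr
  refine ⟨fun u w => ∃ v, Z u v ∧ Y v w, ⟨t, hst, htk⟩, ?_, ?_, ?_⟩
  · rintro u w ⟨v, huv, hvw⟩ p
    exact (hV u v huv p).trans (hV' v w hvw p)
  · rintro a u w ⟨v, huv, hvw⟩ w' hw
    obtain ⟨v', hv, hvw'⟩ := hback' a v w hvw w' hw
    obtain ⟨u', hu, huv'⟩ := hback a u v huv v' hv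
    exact ⟨u', hu, v', huv', hvw'⟩
  · rintro a ha u w ⟨v, huv, hvw⟩ u' hu
    obtain ⟨v', hv, huv'⟩ := hforth a u v huv u' hu
    obtain ⟨w', hw, hvw'⟩ := hforth' a ha v w hvw v' hv
    exact ⟨w', hw, v', huv', hvw'⟩

theorem Bisim.sat_iff {A P : Type} (φ : RForm A P) {M N : KModel A P} {s : M.S} {t : N.S}
    (h : Bisim M s N t) : Sat M s φ ↔ Sat N t φ := by
  induction φ generalizing M N with
  | atom p =>
    obtain ⟨Z, hst, hV, -⟩ := h
    exact hV s t hst p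
  | neg φ ih => exact not_congr (ih h)
  | and φ ψ ihφ ihψ => exact and_congr (ihφ h) (ihψ h)
  | box a φ ih =>
    obtain ⟨Z, hst, hV, hforth, hback⟩ := h
    constructor
    · intro hs t' ht
      obtain ⟨s', hs', hst'⟩ := hback a s t hst t' ht
      exact (ih ⟨Z, hst', hV, hforth, hback⟩).1 (hs s' hs')
    · intro ht s' hs
      obtain ⟨t', ht', hst'⟩ := hforth a s t hst s' hs
      exact (ih ⟨Z, hst', hV, hforth, hback⟩).2 (ht t' ht')
  | rall a φ _ =>
    exact ⟨fun hs K k hk => hs K k (h.refines_trans hk),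
      fun ht K k hk => ht K k (h.symm.refines_trans hk)⟩

/-- `Z` is a bisimulation with respect to the variables of `P`. -/
structure IsMuBisim {A P X : Type} (M N : MuModel A P X) (Z : M.S → N.S → Prop) : Prop where
  atoms : ∀ u v, Z u v → ∀ p, M.V p u ↔ N.V p v
  forth : ∀ a : A, ∀ u v, Z u v → ∀ u', M.R a u u' → ∃ v', N.R a v v' ∧ Z u' v'
  back : ∀ a : A, ∀ u v, Z u v → ∀ v', N.R a v v' → ∃ u', M.R a u u' ∧ Z u' v'

theorem IsMuBisim.symm {A P X : Type} {M N : MuModel A P X} {Z : M.S → N.S → Prop}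
    (h : IsMuBisim M N Z) : IsMuBisim N M (fun v u => Z u v) :=
  ⟨fun u v hz p => (h.atoms v u hz p).symm, fun a u v hz => h.back a v u hz,
    fun a u v hz => h.forth a v u hz⟩

/-- A refinement of a model is a refinement of every bisimilar model. -/
theorem IsMuBisim.refines_trans {A P X : Type} {B : Set A} {M N K : MuModel A P X}
    {Z : M.S → N.S → Prop} (h : IsMuBisim M N Z) {s : M.S} {t : N.S} {k : K.S} (hst : Z s t)
    (hr : MuRefines B N t K k) : MuRefines B M s K k := by
  obtain ⟨Y, htk, hV', hback', hforth'⟩ := hr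
  refine ⟨fun u w => ∃ v, Z u v ∧ Y v w, ⟨t, hst, htk⟩, ?_, ?_, ?_⟩
  · rintro u w ⟨v, huv, hvw⟩ p
    exact (h.atoms u v huv p).trans (hV' v w hvw p)
  · rintro a u w ⟨v, huv, hvw⟩ w' hw
    obtain ⟨v', hv, hvw'⟩ := hback' a v w hvw w' hw
    obtain ⟨u', hu, huv'⟩ := h.back a u v huv v' hv
    exact ⟨u', hu, v', huv', hvw'⟩
  · rintro a ha u w ⟨v, huv, hvw⟩ u' hu
    obtain ⟨v', hv, huv'⟩ := h.forth a u v huv u' hu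
    obtain ⟨w', hw, hvw'⟩ := hforth' a ha v w hvw v' hv
    exact ⟨w', hw, v', huv', hvw'⟩

/-- A bisimulation preserves satisfaction of a well-formed formula, provided that it preserves
the fixpoint variables that occur positively and reflects those that occur negatively. -/
theorem IsMuBisim.sat_of_sat {A P X : Type} (φ : MuForm A P X) (hφ : MuWF φ)
    {M N : MuModel A P X} {Z : M.S → N.S → Prop} (h : IsMuBisim M N Z)
    (hpos : ∀ y, NegIn y φ ∨ ∀ u v, Z u v → M.W y u → N.W y v)
    (hneg : ∀ y, PosIn y φ ∨ ∀ u v, Z u v → N.W y v → M.W y u)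
    {s : M.S} {t : N.S} (hst : Z s t) (hs : MuSat M s φ) : MuSat N t φ := by
  induction φ generalizing M N with
  | fvar x =>
    rcases hpos x with hx | hx
    · simp [NegIn] at hx
    · exact hx s t hst hs
  | atom p => exact (h.atoms s t hst p).1 hs
  | neg φ ih => exact fun ht => hs (ih hφ h.symm
      (fun y => (hneg y).imp_right fun hy u v => hy v u)
      (fun y => (hpos y).imp_right fun hy u v => hy v u) hst ht)
  | and φ ψ ihφ ihψ =>
    simp only [NegIn, PosIn] at hpos hneg
    exact ⟨ihφ hφ.1 h (fun y => (hpos y).imp_left And.left)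
        (fun y => (hneg y).imp_left And.left) hst hs.1,
      ihψ hφ.2 h (fun y => (hpos y).imp_left And.right)
        (fun y => (hneg y).imp_left And.right) hst hs.2⟩
  | box a φ ih =>
    intro t' ht
    obtain ⟨s', hs', hst'⟩ := h.back a s t hst t' ht
    exact ih hφ h hpos hneg hst' (hs s' hs')
  | rall a φ _ => exact fun K k hk => hs K k (h.refines_trans hst hk)
  | mu x φ ih =>
    intro T hT
    simp only [NegIn, PosIn] at hpos hneg
    refine hs {u | ∀ v, Z u v → v ∈ T} (fun u hu v huv => hT ?_) t hst
    refine ih (M := M.updW x {u | ∀ v, Z u v → v ∈ T}) (N := N.updW x T) (Z := Z) hφ.1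
      ⟨h.atoms, h.forth, h.back⟩ (fun y => ?_) (fun y => ?_) huv hu
    · by_cases hxy : y = x
      · subst hxy
        exact Or.inr fun u v huv hu => Or.inl ⟨rfl, (hu.resolve_right fun h' => h'.1 rfl).2 v huv⟩
      · rcases hpos y with (hy | hy) | hy
        · exact absurd hy.symm hxy
        · exact Or.inl hy
        · exact Or.inr fun u v huv hu =>
            Or.inr ⟨hxy, hy u v huv (hu.resolve_left fun h' => hxy h'.1).2⟩
    · by_cases hxy : y = x
      · subst hxy
        exact Or.inl hφ.2
      · rcases hneg y with (hy | hy) | hy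
        · exact absurd hy.symm hxy
        · exact Or.inl hy
        · exact Or.inr fun u v huv hv =>
            Or.inr ⟨hxy, hy u v huv (hv.resolve_left fun h' => hxy h'.1).2⟩

theorem posIn_and_negIn_of_not_freeIn {A P X : Type} (x : X) (φ : MuForm A P X)
    (h : ¬ FreeIn x φ) : PosIn x φ ∧ NegIn x φ := by
  induction φ with
  | fvar y => exact ⟨trivial, h⟩
  | atom p => exact ⟨trivial, trivial⟩
  | neg φ ih => exact (ih h).symm
  | and φ ψ ihφ ihψ =>
    have hφ := ihφ fun h' => h (Or.inl h')
    have hψ := ihψ fun h' => h (Or.inr h')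
    exact ⟨⟨hφ.1, hψ.1⟩, hφ.2, hψ.2⟩
  | box a φ ih => exact ih h
  | rall a φ ih => exact ih h
  | mu y φ ih =>
    by_cases hy : y = x
    · exact ⟨Or.inl hy, Or.inl hy⟩
    · have hφ := ih fun h' => h ⟨hy, h'⟩
      exact ⟨Or.inr hφ.1, Or.inr hφ.2⟩

/-- Bisimulation invariance of refinement modal logic and of the refinement μ-calculus
(the latter for formulas without free fixpoint variables). -/
theorem rml_and_rmlmu_bisimulation_invariant {A P X : Type} :
    (∀ (M : KModel A P) (s : M.S) (N : KModel A P) (t : N.S),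
      Bisim M s N t → ∀ φ : RForm A P, Sat M s φ ↔ Sat N t φ) ∧
    (∀ (M : MuModel A P X) (s : M.S) (N : MuModel A P X) (t : N.S),
      MuBisim M s N t → ∀ φ : MuForm A P X, MuWF φ → (∀ x : X, ¬ FreeIn x φ) →
        (MuSat M s φ ↔ MuSat N t φ)) := by
  refine ⟨fun M s N t h φ => h.sat_iff φ, ?_⟩
  rintro M s N t ⟨Z, hst, hV, hforth, hback⟩ φ hφ hfree
  have h : IsMuBisim M N Z := ⟨hV, hforth, hback⟩
  have hpos y : PosIn y φ := (posIn_and_negIn_of_not_freeIn y φ (hfree y)).1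
  have hneg y : NegIn y φ := (posIn_and_negIn_of_not_freeIn y φ (hfree y)).2
  exact ⟨h.sat_of_sat φ hφ (fun y => Or.inl (hneg y)) (fun y => Or.inl (hpos y)) hst,
    h.symm.sat_of_sat φ hφ (fun y => Or.inl (hneg y)) (fun y => Or.inl (hpos y)) hst⟩
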